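/- For a weakly C(4) finite monoid presentation ⟨A | R⟩: let p be a piece and u a word that is p-inactive. Then p·u ≡ v if and only if v = p·w for some word w with u ≡ w. -/

import Mathlib

open List

/-- A *relation word* is a word occurring as one side of some relation in `R`. -/
def RelWord {A : Type*} (R : Finset (List A × List A)) (w : List A) : Prop :=
  ∃ p ∈ R, w = p.1 ∨ w = p.2

/-- One elementary rewriting step using a defining relation (in either direction). -/
def OneStep {A : Type*} (R : Finset (List A × List A)) (u v : List A) : Prop :=
  ∃ l r x y, ((x, y) ∈ R ∨ (y, x) ∈ R) ∧ u = l ++ x ++ r ∧ v = l ++ y ++ r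

/-- `u ≡ v`: the congruence on the free monoid `A*` generated by the relations `R`. -/
def MEquiv {A : Type*} (R : Finset (List A × List A)) : List A → List A → Prop :=
  Relation.ReflTransGen (OneStep R)

/-- A *piece*: a word occurring as a factor of two distinct relation words, or in two
different (possibly overlapping) positions within one relation word.  The empty word
is a piece. -/
def Piece {A : Type*} (R : Finset (List A × List A)) (p : List A) : Prop :=
  p = [] ∨ ∃ r₁ r₂ a₁ b₁ a₂ b₂, RelWord R r₁ ∧ RelWord R r₂ ∧
    r₁ = a₁ ++ p ++ b₁ ∧ r₂ = a₂ ++ p ++ b₂ ∧ (r₁ ≠ r₂ ∨ a₁ ≠ a₂)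

/-- Weakly `C(n)`: no relation word is a product of strictly fewer than `n` pieces. -/
def WeaklyC {A : Type*} (R : Finset (List A × List A)) (n : ℕ) : Prop :=
  ∀ w, RelWord R w → ∀ L : List (List A), (∀ p ∈ L, Piece R p) → w = L.flatten →
    n ≤ L.length

/-- `X` is the maximal (longest) prefix of `r` which is a piece. -/
def MaxPiecePrefix {A : Type*} (R : Finset (List A × List A)) (r X : List A) : Prop :=
  X <+: r ∧ Piece R X ∧ ∀ p, p <+: r → Piece R p → p.length ≤ X.length

/-- `Z` is the maximal (longest) suffix of `r` which is a piece. -/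
def MaxPieceSuffix {A : Type*} (R : Finset (List A × List A)) (r Z : List A) : Prop :=
  Z <:+ r ∧ Piece R Z ∧ ∀ s, s <:+ r → Piece R s → s.length ≤ Z.length

/-- `X ++ Y ++ Z` is a relation word with maximal piece prefix `X`, middle word `Y`
and maximal piece suffix `Z`. -/
def RelDecomp {A : Type*} (R : Finset (List A × List A)) (X Y Z : List A) : Prop :=
  RelWord R (X ++ Y ++ Z) ∧ MaxPiecePrefix R (X ++ Y ++ Z) X ∧
    MaxPieceSuffix R (X ++ Y ++ Z) Z

/-- `q` is a relation prefix of `u`: a prefix of the form `a ++ X ++ Y` where `X`, `Y`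
are the maximal piece prefix and middle word of some relation word `X ++ Y ++ Z`. -/
def RelPrefix {A : Type*} (R : Finset (List A × List A)) (u q : List A) : Prop :=
  q <+: u ∧ ∃ a X Y Z, q = a ++ X ++ Y ∧ RelDecomp R X Y Z

/-- `a ++ X ++ Y` is an overlap prefix of `u`, with final maximal piece prefix `X` and
middle word `Y`, i.e. it admits a factorisation `b X₁ Y₁' ⋯ X_{n-1} Y_{n-1}' X_n Y_n`
with `X = X_n`, `Y = Y_n`, no factor `X₀ Y₀` beginning strictly before the end of `b`,
each `X_i Y_i Z_i` a relation word factored into maximal piece prefix, middle word and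
maximal piece suffix, and each `Y_i'` (`i < n`) a proper non-empty prefix of `Y_i`. -/
def OPrefix {A : Type*} (R : Finset (List A × List A)) (u a X Y : List A) : Prop :=
  (a ++ X ++ Y) <+: u ∧
  ∃ (b : List A) (n : ℕ) (Xs Ys Zs Ys' : ℕ → List A),
    1 ≤ n ∧ Xs (n - 1) = X ∧ Ys (n - 1) = Y ∧
    a = b ++ ((List.range (n - 1)).map fun i => Xs i ++ Ys' i).flatten ∧
    (∀ i < n, RelDecomp R (Xs i) (Ys i) (Zs i)) ∧
    (∀ i < n - 1, Ys' i ≠ [] ∧ Ys' i <+: Ys i ∧ Ys' i ≠ Ys i) ∧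
    ¬ ∃ c d X₀ Y₀ Z₀, RelDecomp R X₀ Y₀ Z₀ ∧
        a ++ X ++ Y = c ++ X₀ ++ Y₀ ++ d ∧ c.length < b.length

/-- The relation prefix `a ++ X ++ Y` of `u` is *clean*: `u` has no prefix
`a ++ X ++ Y₀ ++ X₁ ++ Y₁` with `Y₀` a proper non-empty prefix of `Y` and `X₁`, `Y₁`
the maximal piece prefix and middle word of some relation word. -/
def CleanAt {A : Type*} (R : Finset (List A × List A)) (u a X Y : List A) : Prop :=
  ¬ ∃ Y₀ X₁ Y₁ Z₁, RelDecomp R X₁ Y₁ Z₁ ∧ Y₀ ≠ [] ∧ Y₀ <+: Y ∧ Y₀ ≠ Y ∧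
      (a ++ X ++ Y₀ ++ X₁ ++ Y₁) <+: u

/-- `a ++ X ++ Y` is a clean overlap prefix of `u`, where `X ++ Y ++ Z` is a relation
word with maximal piece prefix `X`, middle word `Y` and maximal piece suffix `Z`. -/
def CleanOverlapPrefix {A : Type*} (R : Finset (List A × List A))
    (u a X Y Z : List A) : Prop :=
  RelDecomp R X Y Z ∧ OPrefix R u a X Y ∧ CleanAt R u a X Y

/-- `r'` is a complement of the relation word `r`: there is a chain of relation words
from `r` to `r'` each consecutive pair of which forms a relation (in some order). -/
def RelComplement {A : Type*} (R : Finset (List A × List A)) (r r' : List A) : Prop :=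
  RelWord R r ∧ Relation.ReflTransGen (fun s t => (s, t) ∈ R ∨ (t, s) ∈ R) r r'

/-- `u` is `p`-active: `p ++ u` has a relation prefix `a ++ X ++ Y` with `|a| < |p|`. -/
def PActive {A : Type*} (R : Finset (List A × List A)) (p u : List A) : Prop :=
  ∃ a X Y Z, RelDecomp R X Y Z ∧ (a ++ X ++ Y) <+: (p ++ u) ∧ a.length < p.length

/-- `p` is a possible prefix of `u`: `p ++ w ≡ u` for some word `w`. -/
def PossPrefix {A : Type*} (R : Finset (List A × List A)) (p u : List A) : Prop :=
  ∃ w, MEquiv R (p ++ w) u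

/-- `v` is obtained from `u` by exactly `n` elementary rewriting steps. -/
inductive StepsN {A : Type*} (R : Finset (List A × List A)) :
    ℕ → List A → List A → Prop
  | refl (u : List A) : StepsN R 0 u u
  | tail {n : ℕ} {u v w : List A} :
      StepsN R n u v → OneStep R v w → StepsN R (n + 1) u w

theorem StepsN.mEquiv {A : Type*} {R : Finset (List A × List A)} {n : ℕ} {u v : List A}
    (h : StepsN R n u v) : MEquiv R u v := by
  induction h with
  | refl => exact .refl
  | tail _ h ih => exact ih.tail h

theorem MEquiv.exists_stepsN {A : Type*} {R : Finset (List A × List A)} {u v : List A}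
    (h : MEquiv R u v) : ∃ n, StepsN R n u v := by
  induction h with
  | refl => exact ⟨0, .refl u⟩
  | tail _ h ih =>
    obtain ⟨n, hn⟩ := ih
    exact ⟨n + 1, hn.tail h⟩

theorem OneStep.append_left {A : Type*} {R : Finset (List A × List A)} {u v : List A}
    (p : List A) (h : OneStep R u v) : OneStep R (p ++ u) (p ++ v) := by
  obtain ⟨l, r, x, y, hR, rfl, rfl⟩ := h
  exact ⟨p ++ l, r, x, y, hR, by simp, by simp⟩

theorem MEquiv.append_left {A : Type*} {R : Finset (List A × List A)} {u v : List A}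
    (p : List A) (h : MEquiv R u v) : MEquiv R (p ++ u) (p ++ v) :=
  Relation.ReflTransGen.lift (p ++ ·) (fun _ _ => OneStep.append_left p) _ _ h

theorem relWord_of_mem_left {A : Type*} {R : Finset (List A × List A)} {x y : List A}
    (h : (x, y) ∈ R ∨ (y, x) ∈ R) : RelWord R x :=
  h.elim (fun h => ⟨_, h, .inl rfl⟩) (fun h => ⟨_, h, .inr rfl⟩)

theorem Piece.suffix {A : Type*} {R : Finset (List A × List A)} {p q : List A}
    (hp : Piece R p) (h : q <:+ p) : Piece R q := by
  obtain ⟨c, rfl⟩ := h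
  rcases hp with hp | ⟨r₁, r₂, a₁, b₁, a₂, b₂, h₁, h₂, e₁, e₂, hne⟩
  · exact .inl (List.append_eq_nil_iff.1 hp).2
  · refine .inr ⟨r₁, r₂, a₁ ++ c, b₁, a₂ ++ c, b₂, h₁, h₂, by simp [e₁], by simp [e₂], ?_⟩
    simpa using hne

theorem exists_maxPiecePrefix {A : Type*} (R : Finset (List A × List A)) (r : List A) :
    ∃ X, MaxPiecePrefix R r X := by
  classical
  set m := Nat.findGreatest (fun k => Piece R (r.take k)) r.length
  refine ⟨r.take m, List.take_prefix _ _, ?_, fun p hp hpp => ?_⟩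
  · exact Nat.findGreatest_spec (P := fun k => Piece R (r.take k)) (Nat.zero_le _)
      (.inl (by simp))
  · have h : p.length ≤ m := Nat.le_findGreatest hp.length_le
      (by rwa [← List.prefix_iff_eq_take.1 hp])
    have := hp.length_le
    simp only [List.length_take]
    omega

theorem exists_maxPieceSuffix {A : Type*} (R : Finset (List A × List A)) (r : List A) :
    ∃ Z, MaxPieceSuffix R r Z := by
  classical
  set m := Nat.findGreatest (fun k => Piece R (r.drop (r.length - k))) r.length
  refine ⟨r.drop (r.length - m), List.drop_suffix _ _, ?_, fun p hp hpp => ?_⟩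
  · exact Nat.findGreatest_spec (P := fun k => Piece R (r.drop (r.length - k)))
      (Nat.zero_le _) (.inl (by simp))
  · have h : p.length ≤ m := Nat.le_findGreatest hp.length_le
      (by rwa [← List.suffix_iff_eq_drop.1 hp])
    have := hp.length_le
    simp only [List.length_drop]
    omega

theorem RelWord.exists_relDecomp {A : Type*} {R : Finset (List A × List A)}
    (hC : WeaklyC R 3) {r : List A} (hr : RelWord R r) :
    ∃ X Y Z, r = X ++ Y ++ Z ∧ RelDecomp R X Y Z := by
  obtain ⟨X, hX⟩ := exists_maxPiecePrefix R r
  obtain ⟨Z, hZ⟩ := exists_maxPieceSuffix R r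
  obtain ⟨S, rfl⟩ := hX.1
  have hS : Z <:+ S := by
    rcases List.suffix_or_suffix_of_suffix hZ.1 (List.suffix_append X S) with h | h
    · exact h
    · have := hC _ hr [X, S] (by simp [hX.2.1, hZ.2.1.suffix h]) (by simp)
      simp at this
  obtain ⟨Y, rfl⟩ := hS
  rw [← List.append_assoc] at hr hX hZ
  exact ⟨X, Y, Z, by simp, hr, hX, hZ⟩

/-- In a relation word `X ++ Y ++ Z` followed by any word, no `X' ++ Y'` starts strictly
inside `X ++ Y`. -/
theorem RelDecomp.not_overlap {A : Type*} {R : Finset (List A × List A)}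
    (hC : WeaklyC R 3) {X Y Z X' Y' Z' s t h : List A} (hd : RelDecomp R X Y Z)
    (hd' : RelDecomp R X' Y' Z') (hs : s ≠ []) (hlt : s.length < (X ++ Y).length)
    (he : X ++ Y ++ Z ++ t = s ++ (X' ++ Y') ++ h) : False := by
  obtain ⟨hr, -, -, -, hZmax⟩ := hd
  obtain ⟨hr', -, -, hZ', -⟩ := hd'
  have hsp : s <+: X ++ Y ++ Z := by
    refine List.prefix_of_prefix_length_le (l₃ := X ++ Y ++ Z ++ t) ?_
      (List.prefix_append _ _) ?_
    · rw [he, List.append_assoc]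
      exact List.prefix_append _ _
    · simp only [List.length_append] at hlt ⊢
      omega
  obtain ⟨o, ho⟩ := hsp
  rw [← ho, List.append_assoc, List.append_assoc, List.append_cancel_left_eq] at he
  rcases List.append_eq_append_iff.1 he with ⟨c, hc, -⟩ | ⟨c, hc, -⟩
  · have hp : Piece R o := .inr ⟨_, _, s, [], [], c ++ Z', hr, hr', by simp [ho],
      by simp [hc], .inr hs⟩
    have := hZmax o ⟨s, ho⟩ hp
    have hl := congrArg List.length ho
    simp only [List.length_append] at hl hlt
    omega
  · have hp : Piece R (X' ++ Y') := .inr ⟨_, _, s, c, [], Z', hr, hr', by simp [← ho, hc],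
      by simp, .inr hs⟩
    have := hC _ hr' [X' ++ Y', Z'] (by simp only [List.mem_cons]; grind) (by simp)
    simp at this

/-- Either the prefix `P` of `p ++ u'` is left untouched by the rewriting of `u` into `u'`,
or there is a last step overlapping it. -/
theorem StepsN.prefix_or_last_step {A : Type*} {R : Finset (List A × List A)} {n : ℕ}
    {p u u' P g' : List A} (h : StepsN R n u u') (he : p ++ u' = P ++ g') :
    P <+: p ++ u ∨ ∃ m < n, ∃ c r d g, RelWord R r ∧ p ++ (c ++ r ++ d) = P ++ g ∧
      (p ++ c).length < P.length ∧ StepsN R m g g' := by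
  suffices H : (∃ g, p ++ u = P ++ g ∧ StepsN R n g g') ∨
      ∃ m < n, ∃ c r d g, RelWord R r ∧ p ++ (c ++ r ++ d) = P ++ g ∧
        (p ++ c).length < P.length ∧ StepsN R m g g' by
    exact H.imp_left fun ⟨g, hg, _⟩ => ⟨g, hg.symm⟩
  induction h generalizing g' with
  | refl => exact .inl ⟨g', he, .refl _⟩
  | @tail n u v w _ hvw ih =>
    obtain ⟨l, r, x, y, hR, rfl, rfl⟩ := hvw
    by_cases hlen : (p ++ l).length < P.length
    · exact .inr ⟨0, Nat.succ_pos _, l, y, r, g', relWord_of_mem_left hR.symm, he, hlen,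
        .refl _⟩
    · have hP : P <+: p ++ l := by
        refine List.prefix_of_prefix_length_le (l₃ := P ++ g') (List.prefix_append _ _) ?_
          (not_lt.1 hlen)
        rw [← he]
        exact ⟨y ++ r, by simp⟩
      obtain ⟨e, hPe⟩ := hP
      have hg : g' = e ++ y ++ r := by
        have : P ++ g' = P ++ (e ++ y ++ r) := by
          rw [← he, ← List.append_assoc, ← List.append_assoc, ← hPe]
          simp
        exact List.append_cancel_left this
      have hstep : OneStep R (e ++ x ++ r) g' := ⟨e, r, x, y, hR, rfl, hg⟩
      have hpx : p ++ (l ++ x ++ r) = P ++ (e ++ x ++ r) := by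
        rw [← List.append_assoc, ← List.append_assoc, ← hPe]
        simp
      rcases ih hpx with ⟨g, h₁, h₂⟩ | ⟨m, hm, c, r', d, g, h₁, h₂, h₃, h₄⟩
      · exact .inl ⟨g, h₁, h₂.tail hstep⟩
      · exact .inr ⟨m + 1, by omega, c, r', d, g, h₁, h₂, h₃, h₄.tail hstep⟩

/-- Rewriting a word `p ++ u` with `u` a `p`-inactive word never touches the prefix `p`. -/
theorem StepsN.exists_of_not_pActive {A : Type*} {R : Finset (List A × List A)}
    (hC : WeaklyC R 3) {n : ℕ} {p u v : List A} (hin : ¬ PActive R p u)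
    (h : StepsN R n (p ++ u) v) : ∃ w, v = p ++ w ∧ StepsN R n u w := by
  induction n using Nat.strong_induction_on generalizing p u v with
  | _ n IH =>
  obtain _ | n := n
  · cases h
    exact ⟨u, rfl, .refl u⟩
  cases h with | @tail _ _ v' _ h hs =>
  obtain ⟨u', rfl, hu'⟩ := IH n n.lt_succ_self hin h
  obtain ⟨l, t, x, y, hR, he, rfl⟩ := hs
  rcases Nat.lt_or_ge l.length p.length with hlp | hlp
  · exfalso
    obtain ⟨X, Y, Z, rfl, hd⟩ := (relWord_of_mem_left hR).exists_relDecomp hC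
    have he' : p ++ u' = (l ++ X ++ Y) ++ (Z ++ t) := by simp [he]
    rcases hu'.prefix_or_last_step he' with hpre | ⟨m, hm, c, r, d, g, hr, hg, hlen, hgg⟩
    · exact hin ⟨l, X, Y, Z, hd, hpre, hlp⟩
    · obtain ⟨X', Y', Z', rfl, hd'⟩ := hr.exists_relDecomp hC
      have hlpc : l <+: p ++ c := by
        refine List.prefix_of_prefix_length_le (l₃ := (l ++ X ++ Y) ++ g)
          ⟨X ++ Y ++ g, by simp⟩ ?_ (by simp only [List.length_append]; omega)
        rw [← hg]
        exact ⟨X' ++ Y' ++ Z' ++ d, by simp⟩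
      obtain ⟨s, hs⟩ := hlpc
      have hs0 : s ≠ [] := by
        rintro rfl
        have := congrArg List.length hs
        simp only [List.length_append, List.length_nil] at this
        omega
      have hslt : s.length < (X ++ Y).length := by
        have := congrArg List.length hs
        simp only [List.length_append] at this hlen ⊢
        omega
      have hg' : s ++ (X' ++ Y' ++ (Z' ++ d)) = X ++ Y ++ g := by
        apply List.append_cancel_left (as := l)
        rw [← List.append_assoc, hs]
        simpa using hg
      obtain ⟨q, hq⟩ : s <+: X ++ Y :=
        List.prefix_of_prefix_length_le (l₃ := X ++ Y ++ g)
          (hg' ▸ List.prefix_append _ _) (List.prefix_append _ _) hslt.le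
      have hq0 : q ≠ [] := by
        rintro rfl
        rw [← hq] at hslt
        simp at hslt
      rw [← hq, List.append_assoc s q g, List.append_cancel_left_eq] at hg'
      rcases List.append_eq_append_iff.1 hg' with ⟨z, hz, -⟩ | ⟨z, hz, hgz⟩
      · refine hd.not_overlap hC hd' hs0 hslt (t := []) (h := z ++ Z) ?_
        rw [← hq, hz]
        simp
      · have hz' : ¬ PActive R z (Z' ++ d) := by
          rintro ⟨a, X₁, Y₁, Z₁, hd₁, ⟨f, hf⟩, ha⟩
          refine hd'.not_overlap hC hd₁ (s := q ++ a) (t := d) (h := f) (by simp [hq0]) ?_ ?_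
          · simp only [hz, List.length_append]
            omega
          · rw [hz]
            simpa using hf.symm
        obtain ⟨h, hh, -⟩ := IH m (by omega) hz' (hgz ▸ hgg)
        refine hd.not_overlap hC hd' hs0 hslt (t := t) (h := h) ?_
        rw [hz, List.append_assoc, hh, ← hq]
        simp
  · obtain ⟨e, rfl⟩ : p <+: l := List.prefix_of_prefix_length_le (l₃ := p ++ u')
      (List.prefix_append _ _) (he ▸ ⟨x ++ t, by simp⟩) hlp
    refine ⟨e ++ y ++ t, by simp, hu'.tail ⟨e, t, x, y, hR, ?_, rfl⟩⟩
    simpa using he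

/-- Proposition 8: for a weakly `C(4)` finite monoid presentation,
let `p` be a piece and `u` a `p`-inactive word.  Then `p ++ u ≡ v` if and only if
`v = p ++ w` for some word `w` with `u ≡ w`. -/
theorem pInactive_equiv_iff {A : Type*} [Fintype A] [DecidableEq A]
    (R : Finset (List A × List A)) (hC : WeaklyC R 4)
    (p u : List A) (hp : Piece R p) (hin : ¬ PActive R p u) (v : List A) :
    MEquiv R (p ++ u) v ↔ ∃ w, v = p ++ w ∧ MEquiv R u w := by
  constructor
  · intro h
    obtain ⟨n, hn⟩ := h.exists_stepsN
    obtain ⟨w, hw, hs⟩ := hn.exists_of_not_pActive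
      (fun r hr L hL e => (by norm_num : 3 ≤ 4).trans (hC r hr L hL e)) hin
    exact ⟨w, hw, hs.mEquiv⟩
  · rintro ⟨w, rfl, h⟩
    exact h.append_left p
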